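/- arXiv:2306.02338 — 3 statements merged into one kernel-verified Lean document; each statement's English description precedes it below -/
import Mathlib

section
/- Let G = (V, E) be a finite simple undirected graph with n = |V| ≥ 1, ℓ : V → C a coloring, α a real number with 1/|C| ≤ α ≤ 1, and γ ∈ [0,1]. Assume α(V) ≤ α, and let OPT = max{ d(T) : ∅ ≠ T ⊆ V, α(T) ≤ α }. If S ⊆ V satisfies |S| ≥ ⌈1/α⌉ and d(S) ≥ γ · max{ d(T) : T ⊆ V, |T| ≥ ⌈1/α⌉ }, then there exists T with S ⊆ T ⊆ V such that α(T) ≤ α and d(T) ≥ (γ/√(2n)) · OPT. (In particular, max{1/⌈1/α⌉, 1/(α·n)} ≥ 1/√(⌈1/α⌉ · α · n) ≥ 1/√(2n).) -/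
open Finset

/-- The set of edges of `G` with both endpoints in `S`. -/
def edgesIn {V : Type*} [Fintype V] [DecidableEq V] (G : SimpleGraph V) [DecidableRel G.Adj]
    (S : Finset V) : Finset (Sym2 V) :=
  G.edgeFinset.filter (fun e => ∀ v ∈ e, v ∈ S)

/-- The (degree) density `d(S) = |E(S)|/|S|`. -/
noncomputable def density {V : Type*} [Fintype V] [DecidableEq V] (G : SimpleGraph V)
    [DecidableRel G.Adj] (S : Finset V) : ℝ :=
  ((edgesIn G S).card : ℝ) / S.card

/-- `S_c`, the set of nodes of `S` with color `c`. -/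
def colorClass {V C : Type*} [DecidableEq V] [DecidableEq C] (ℓ : V → C) (S : Finset V) (c : C) :
    Finset V := S.filter (fun v => ℓ v = c)

/-- `c_max(S)`, the maximum number of nodes of `S` sharing a single color. -/
def cmax {V C : Type*} [DecidableEq V] [Fintype C] [DecidableEq C] (ℓ : V → C) (S : Finset V) : ℕ :=
  Finset.univ.sup (fun c => (colorClass ℓ S c).card)

/-- `α(S) = c_max(S)/|S|`, the maximum fraction of monochromatic nodes in `S`. -/
noncomputable def alphaOf {V C : Type*} [DecidableEq V] [Fintype C] [DecidableEq C]
    (ℓ : V → C) (S : Finset V) : ℝ := (cmax ℓ S : ℝ) / S.card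

theorem aux_sum {V C : Type*} [Fintype V] [DecidableEq V] [Fintype C] [DecidableEq C]
    (ℓ : V → C) (T : Finset V) : T.card = ∑ c, (colorClass ℓ T c).card :=
  Finset.card_eq_sum_card_fiberwise (fun _ _ => Finset.mem_coe.2 (Finset.mem_univ _))

theorem aux_alpha_le {V C : Type*} [DecidableEq V] [Fintype C] [DecidableEq C]
    (ℓ : V → C) (T : Finset V) (α : ℝ) (hα : 0 ≤ α)
    (h : ∀ c, ((colorClass ℓ T c).card : ℝ) ≤ α * T.card) : alphaOf ℓ T ≤ α := by
  unfold alphaOf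
  apply div_le_of_le_mul₀ (by positivity) hα
  have h0 : cmax ℓ T ≤ ⌊α * T.card⌋₊ :=
    Finset.sup_le (fun c _ => Nat.le_floor (h c))
  exact (Nat.le_floor_iff (by positivity)).1 h0

theorem aux_alpha {V C : Type*} [DecidableEq V] [Fintype C] [DecidableEq C]
    (ℓ : V → C) (T : Finset V) (hT : T.Nonempty) (α : ℝ)
    (h : alphaOf ℓ T ≤ α) (c : C) : ((colorClass ℓ T c).card : ℝ) ≤ α * T.card := by
  unfold alphaOf at h
  have hp : (0 : ℝ) < T.card := by exact_mod_cast hT.card_pos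
  rw [div_le_iff₀ hp] at h
  refine le_trans ?_ h
  exact_mod_cast Finset.le_sup (f := fun c => (colorClass ℓ T c).card) (Finset.mem_univ c)

theorem aux_one {V C : Type*} [DecidableEq V] [Fintype C] [DecidableEq C]
    (ℓ : V → C) (T : Finset V) (hT : T.Nonempty) (α : ℝ)
    (h : alphaOf ℓ T ≤ α) : 1 ≤ α * T.card := by
  obtain ⟨v, hv⟩ := hT
  refine le_trans ?_ (aux_alpha ℓ T ⟨v, hv⟩ α h (ℓ v))
  have : 0 < (colorClass ℓ T (ℓ v)).card :=
    Finset.card_pos.2 ⟨v, by simp [colorClass, hv]⟩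
  exact_mod_cast this

theorem aux_dens {V : Type*} [Fintype V] [DecidableEq V] (G : SimpleGraph V)
    [DecidableRel G.Adj] (S T : Finset V) (hS : S.Nonempty) (hST : S ⊆ T) (r : ℝ) (hr : 0 < r)
    (h : (T.card : ℝ) ≤ r * S.card) : density G S * (1 / r) ≤ density G T := by
  have hs : (0 : ℝ) < S.card := by exact_mod_cast hS.card_pos
  have ht : (0 : ℝ) < T.card := by exact_mod_cast (hS.mono hST).card_pos
  have hE : ((edgesIn G S).card : ℝ) ≤ (edgesIn G T).card := by
    norm_cast
    apply Finset.card_le_card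
    intro e he
    simp only [edgesIn, Finset.mem_filter] at he ⊢
    exact ⟨he.1, fun v hv => hST (he.2 v hv)⟩
  unfold density
  rw [div_mul_div_comm, mul_one, mul_comm (S.card : ℝ) r]
  gcongr

set_option maxHeartbeats 1000000 in
theorem aux_extend {V C : Type*} [Fintype V] [DecidableEq V] [Fintype C] [DecidableEq C]
    (ℓ : V → C) (α : ℝ) (hα : 0 < α) (S : Finset V) (hS : S.Nonempty)
    (hV : alphaOf ℓ (Finset.univ : Finset V) ≤ α) :
    ∃ T : Finset V, S ⊆ T ∧ alphaOf ℓ T ≤ α ∧ T.card ≤ ⌈1 / α⌉₊ * S.card := by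
  set k := ⌈1 / α⌉₊ with hk
  set s := S.card with hs
  have hspos : 0 < s := hS.card_pos
  have hkα : 1 ≤ α * k := by
    have := Nat.le_ceil (1 / α)
    rw [div_le_iff₀ hα] at this
    linarith
  have hkpos : 1 ≤ k := Nat.one_le_ceil_iff.2 (by positivity)
  have hVc := aux_alpha ℓ univ (hS.mono (subset_univ _)) α hV
  set W : C → ℕ := fun c => (colorClass ℓ (univ : Finset V) c).card with hW
  have hex : ∀ c, ∃ U : Finset V, colorClass ℓ S c ⊆ U ∧ U ⊆ colorClass ℓ univ c ∧
      U.card = min (W c) s := by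
    intro c
    apply Finset.exists_subsuperset_card_eq
    · exact Finset.filter_subset_filter _ (subset_univ _)
    · exact le_min (Finset.card_le_card (Finset.filter_subset_filter _ (subset_univ _)))
        (Finset.card_le_card (Finset.filter_subset _ _))
    · exact min_le_left _ _
  choose U hU1 hU2 hU3 using hex
  set T0 : Finset V := univ.biUnion U with hT0
  have hST0 : S ⊆ T0 := by
    intro v hv
    exact Finset.mem_biUnion.2 ⟨ℓ v, mem_univ _, hU1 _ (by simp [colorClass, hv])⟩
  have hcl : ∀ c, colorClass ℓ T0 c = U c := by
    intro c
    ext v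
    simp only [colorClass, Finset.mem_filter, hT0, Finset.mem_biUnion, mem_univ, true_and]
    constructor
    · rintro ⟨⟨d, hd⟩, hc⟩
      have := hU2 d hd
      simp only [colorClass, Finset.mem_filter, mem_univ, true_and] at this
      rw [← hc, this]
      exact hd
    · intro h
      have := hU2 c h
      simp only [colorClass, Finset.mem_filter, mem_univ, true_and] at this
      exact ⟨⟨c, h⟩, this⟩
  have hN : T0.card = ∑ c, min (W c) s := by
    rw [aux_sum ℓ T0]
    exact Finset.sum_congr rfl (fun c _ => by rw [hcl, hU3])
  rcases le_total (k * s) T0.card with hbig | hsmall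
  · obtain ⟨T, h1, h2, h3⟩ := Finset.exists_subsuperset_card_eq hST0
      (show S.card ≤ k * s from Nat.le_mul_of_pos_left _ hkpos) hbig
    refine ⟨T, h1, aux_alpha_le ℓ T α hα.le ?_, h3.le⟩
    intro c
    have hle : (colorClass ℓ T c).card ≤ s := by
      calc (colorClass ℓ T c).card ≤ (colorClass ℓ T0 c).card :=
            Finset.card_le_card (Finset.filter_subset_filter _ h2)
        _ ≤ s := by rw [hcl, hU3]; exact min_le_right _ _
    have hle' : ((colorClass ℓ T c).card : ℝ) ≤ s := by exact_mod_cast hle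
    rw [h3]
    push_cast
    have hs0 : (0 : ℝ) ≤ s := by positivity
    nlinarith
  · refine ⟨T0, hST0, aux_alpha_le ℓ T0 α hα.le ?_, hsmall⟩
    intro c
    rw [hcl, hU3]
    set B : Finset C := univ.filter (fun c => s ≤ W c) with hB
    set R : ℕ := ∑ c ∈ univ.filter (fun c => ¬ s ≤ W c), W c with hR
    have hNR : T0.card = B.card * s + R := by
      rw [hN, ← Finset.sum_filter_add_sum_filter_not univ (fun c => s ≤ W c)]
      congr 1
      · rw [Finset.sum_congr rfl (g := fun _ => s), Finset.sum_const, smul_eq_mul]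
        intro c hc
        exact min_eq_right (Finset.mem_filter.1 hc).2
      · apply Finset.sum_congr rfl
        intro c hc
        exact min_eq_left (not_le.1 (Finset.mem_filter.1 hc).2).le
    have hnR : (univ : Finset V).card = ∑ c ∈ B, W c + R := by
      rw [aux_sum ℓ univ, ← Finset.sum_filter_add_sum_filter_not univ (fun c => s ≤ W c)]
    set n : ℕ := (univ : Finset V).card with hn
    rcases Finset.eq_empty_or_nonempty B with hBe | ⟨b, hb⟩
    · have h1 : T0.card = n := by rw [hNR, hnR, hBe]; simp
      rw [h1]
      refine le_trans ?_ (hVc c)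
      exact_mod_cast min_le_left _ _
    · have hsn : (s : ℝ) ≤ α * n := by
        refine le_trans ?_ (hVc b)
        exact_mod_cast (Finset.mem_filter.1 hb).2
      have hsum : ((∑ c ∈ B, W c : ℕ) : ℝ) ≤ B.card * (α * n) := by
        push_cast
        rw [← nsmul_eq_mul]
        exact Finset.sum_le_card_nsmul _ _ _ (fun c _ => hVc c)
      have hnR' : (n : ℝ) = (∑ c ∈ B, W c : ℕ) + (R : ℝ) := by exact_mod_cast hnR
      have hmin : ((min (W c) s : ℕ) : ℝ) ≤ s := by exact_mod_cast min_le_right _ _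
      refine hmin.trans ?_
      have hNR' : (T0.card : ℝ) = B.card * s + R := by exact_mod_cast hNR
      have hpk : B.card ≤ k := by
        have : B.card * s ≤ k * s := by omega
        exact Nat.le_of_mul_le_mul_right this hspos
      have hs0 : (0 : ℝ) < s := by exact_mod_cast hspos
      have hR0 : (0 : ℝ) ≤ R := Nat.cast_nonneg _
      rw [hNR']
      rcases le_total 1 (α * B.card) with h1 | h1
      · nlinarith [mul_nonneg hα.le hR0]
      · have h2 : (n : ℝ) * (1 - α * B.card) ≤ R := by nlinarith
        have h3 : (s : ℝ) * (1 - α * B.card) ≤ α * n * (1 - α * B.card) :=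
          mul_le_mul_of_nonneg_right hsn (by linarith)
        have h4 := mul_le_mul_of_nonneg_left h2 hα.le
        nlinarith

theorem aux_max (a b : ℝ) (ha : 0 < a) (hb : 0 < b) :
    1 / Real.sqrt (a * b) ≤ max (1 / a) (1 / b) := by
  rcases le_total a b with h | h
  · refine le_trans ?_ (le_max_left _ _)
    apply one_div_le_one_div_of_le ha
    exact Real.le_sqrt_of_sq_le (by nlinarith)
  · refine le_trans ?_ (le_max_right _ _)
    apply one_div_le_one_div_of_le hb
    exact Real.le_sqrt_of_sq_le (by nlinarith)

/-- `Ω(1/√n)`-approximation: a `γ`-approximate solution to DalkS with `k = ⌈1/α⌉`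
extends to a diverse set `T` with `d(T) ≥ (γ/√(2n)) · OPT`; in particular
`max{1/⌈1/α⌉, 1/(αn)} ≥ 1/√(⌈1/α⌉·α·n) ≥ 1/√(2n)`. -/
theorem stmt6 {V C : Type*} [Fintype V] [DecidableEq V] [Fintype C] [DecidableEq C]
    (G : SimpleGraph V) [DecidableRel G.Adj] (ℓ : V → C) (α : ℝ)
    (hα₁ : 1 / (Fintype.card C : ℝ) ≤ α) (hα₂ : α ≤ 1) (hn : 1 ≤ Fintype.card V)
    (γ : ℝ) (hγ0 : 0 ≤ γ) (hγ1 : γ ≤ 1)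
    (hV : alphaOf ℓ (Finset.univ : Finset V) ≤ α)
    (S : Finset V) (hScard : ⌈1 / α⌉₊ ≤ S.card)
    (hSdens : γ * sSup {x : ℝ | ∃ T : Finset V, ⌈1 / α⌉₊ ≤ T.card ∧ density G T = x}
      ≤ density G S) :
    (∃ T : Finset V, S ⊆ T ∧ alphaOf ℓ T ≤ α ∧
      (γ / Real.sqrt (2 * Fintype.card V)) *
        sSup {x : ℝ | ∃ T' : Finset V, T'.Nonempty ∧ alphaOf ℓ T' ≤ α ∧ density G T' = x}
      ≤ density G T) ∧
    max (1 / (⌈1 / α⌉₊ : ℝ)) (1 / (α * Fintype.card V))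
      ≥ 1 / Real.sqrt ((⌈1 / α⌉₊ : ℝ) * α * Fintype.card V) ∧
    1 / Real.sqrt ((⌈1 / α⌉₊ : ℝ) * α * Fintype.card V)
      ≥ 1 / Real.sqrt (2 * Fintype.card V) := by
  have hVne : (univ : Finset V).Nonempty := Finset.card_pos.1 (by rw [Finset.card_univ]; omega)
  have hn0 : (0 : ℝ) < Fintype.card V := by exact_mod_cast hn
  have hαn : 1 ≤ α * Fintype.card V := by
    have := aux_one ℓ univ hVne α hV
    rwa [Finset.card_univ] at this
  have hα : 0 < α := by
    by_contra h
    nlinarith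
  have hk1 : 1 ≤ ⌈1 / α⌉₊ := Nat.one_le_ceil_iff.2 (by positivity)
  have hk0 : (0 : ℝ) < ⌈1 / α⌉₊ := by exact_mod_cast hk1
  have hSne : S.Nonempty := Finset.card_pos.1 (by omega)
  have hk2 : (⌈1 / α⌉₊ : ℝ) * α ≤ 2 := by
    have h1 := (Nat.ceil_lt_add_one (a := 1 / α) (by positivity)).le
    have h2 := mul_le_mul_of_nonneg_right h1 hα.le
    rw [add_mul, div_mul_cancel₀ _ hα.ne'] at h2
    linarith
  have hA : max (1 / (⌈1 / α⌉₊ : ℝ)) (1 / (α * Fintype.card V))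
      ≥ 1 / Real.sqrt ((⌈1 / α⌉₊ : ℝ) * α * Fintype.card V) := by
    rw [mul_assoc]
    exact aux_max _ _ hk0 (by positivity)
  have hB : 1 / Real.sqrt ((⌈1 / α⌉₊ : ℝ) * α * Fintype.card V)
      ≥ 1 / Real.sqrt (2 * Fintype.card V) := by
    apply one_div_le_one_div_of_le (Real.sqrt_pos.2 (by positivity))
    apply Real.sqrt_le_sqrt
    gcongr
  refine ⟨?_, hA, hB⟩
  have hbdd : BddAbove {x : ℝ | ∃ T : Finset V, ⌈1 / α⌉₊ ≤ T.card ∧ density G T = x} := by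
    apply Set.Finite.bddAbove
    apply (Set.finite_range (fun T : Finset V => density G T)).subset
    rintro x ⟨T, -, rfl⟩
    exact ⟨T, rfl⟩
  have hOPT : sSup {x : ℝ | ∃ T' : Finset V, T'.Nonempty ∧ alphaOf ℓ T' ≤ α ∧ density G T' = x}
      ≤ sSup {x : ℝ | ∃ T : Finset V, ⌈1 / α⌉₊ ≤ T.card ∧ density G T = x} := by
    refine csSup_le_csSup hbdd ⟨density G univ, univ, hVne, hV, rfl⟩ ?_
    rintro x ⟨T, hT, hTα, rfl⟩
    refine ⟨T, Nat.ceil_le.2 ?_, rfl⟩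
    rw [div_le_iff₀ hα]
    linarith [aux_one ℓ T hT α hTα]
  have hdS := (mul_le_mul_of_nonneg_left hOPT hγ0).trans hSdens
  have hd0 : 0 ≤ density G S := by unfold density; positivity
  have key : ∃ T : Finset V, S ⊆ T ∧ alphaOf ℓ T ≤ α ∧
      density G S * max (1 / (⌈1 / α⌉₊ : ℝ)) (1 / (α * Fintype.card V)) ≤ density G T := by
    rcases max_choice (1 / (⌈1 / α⌉₊ : ℝ)) (1 / (α * Fintype.card V)) with h | h
    · obtain ⟨T, h1, h2, h3⟩ := aux_extend ℓ α hα S hSne hV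
      refine ⟨T, h1, h2, ?_⟩
      rw [h]
      exact aux_dens G S T hSne h1 _ hk0 (by exact_mod_cast h3)
    · refine ⟨univ, subset_univ _, hV, ?_⟩
      rw [h]
      apply aux_dens G S univ hSne (subset_univ _) _ (by positivity)
      rw [Finset.card_univ]
      have h1 : 1 / α ≤ (S.card : ℝ) := Nat.ceil_le.1 hScard
      rw [div_le_iff₀ hα] at h1
      nlinarith
  obtain ⟨T, h1, h2, h3⟩ := key
  refine ⟨T, h1, h2, le_trans ?_ h3⟩
  have h4 := mul_le_mul_of_nonneg_left (hB.le.trans hA.le) hd0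
  have h5 : (0 : ℝ) ≤ 1 / Real.sqrt (2 * Fintype.card V) := by positivity
  have h6 := mul_le_mul_of_nonneg_right hdS h5
  refine le_trans (le_of_eq ?_) (h6.trans h4)
  ring
end

section
/- Let G = (V, E) be a finite simple undirected graph, ℓ : V → C a coloring, and k⃗ = (k_c)_{c∈C} ∈ ℤ_{≥0}^{|C|} with k_c ≥ 1 for some c ∈ C. Let S* ⊆ V be an optimal solution to Dal k⃗ S, let p*_c = |S*_c| for each c ∈ C, let (x*, y*) be an optimal solution to LP(p*), and let λ = Σ_{e∈E} x*_e be its objective value. Then there exists r ∈ {y*_v : v ∈ V} ∪ {0} such that S(r) = {v ∈ V : y*_v ≥ r} satisfies (exactly) one of the following: (1) d(S(r)) ≥ λ/3 and C_sat(S(r)) = C; (2) |E(S(r))| / ( Σ_{c∈C_sat(S(r))} |S(r)_c| + Σ_{c∈C∖C_sat(S(r))} k_c ) ≥ λ/3, with C_sat(S(r)) ≠ ∅ and C_sat(S(r)) ≠ C; (3) |E(S(r))| ≥ |E(S*)|/3 and C_sat(S(r)) = ∅. -/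
open Finset

/-- `C_sat(S)`, the set of colors whose demand is satisfied by `S`. -/
def Csat {V C : Type*} [DecidableEq V] [Fintype C] [DecidableEq C] (ℓ : V → C) (k : C → ℕ)
    (S : Finset V) : Finset C :=
  Finset.univ.filter (fun c => k c ≤ (colorClass ℓ S c).card)

/-- Feasibility for the linear program `LP(p)`. -/
def LPFeasible {V C : Type*} [Fintype V] [DecidableEq V] [Fintype C] [DecidableEq C]
    (G : SimpleGraph V) [DecidableRel G.Adj] (ℓ : V → C) (p : C → ℕ)
    (x : Sym2 V → ℝ) (y : V → ℝ) : Prop :=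
  (∀ e ∈ G.edgeFinset, ∀ v ∈ e, x e ≤ y v) ∧
  (∀ c : C, ∑ v ∈ Finset.univ.filter (fun v => ℓ v = c), y v
      = (p c : ℝ) / ((∑ c' : C, p c' : ℕ) : ℝ)) ∧
  (∀ v : V, y v ≤ 1 / ((∑ c' : C, p c' : ℕ) : ℝ)) ∧
  (∀ e ∈ G.edgeFinset, 0 ≤ x e) ∧
  (∀ v : V, 0 ≤ y v)


lemma aux_int (a M : ℝ) (h0 : 0 ≤ a) (hM : a ≤ M) :
    IntervalIntegrable (fun r : ℝ => if r ≤ a then (1:ℝ) else 0) MeasureTheory.volume 0 M ∧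
    ∫ r in (0:ℝ)..M, (if r ≤ a then (1:ℝ) else 0) = a := by
  have hanti : Antitone (fun r : ℝ => if r ≤ a then (1:ℝ) else 0) := by
    intro s t hst
    dsimp only
    split_ifs <;> linarith
  have hi : ∀ u w : ℝ, IntervalIntegrable (fun r : ℝ => if r ≤ a then (1:ℝ) else 0)
      MeasureTheory.volume u w := fun u w => hanti.intervalIntegrable
  refine ⟨hi _ _, ?_⟩
  rw [← intervalIntegral.integral_add_adjacent_intervals (hi 0 a) (hi a M)]
  have h1 : ∫ r in (0:ℝ)..a, (if r ≤ a then (1:ℝ) else 0) = ∫ r in (0:ℝ)..a, (1:ℝ) := by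
    apply intervalIntegral.integral_congr_uIoo
    intro r hr
    rw [Set.uIoo_of_le h0] at hr
    simp [hr.2.le]
  have h2 : ∫ r in a..M, (if r ≤ a then (1:ℝ) else 0) = ∫ r in a..M, (0:ℝ) := by
    apply intervalIntegral.integral_congr_uIoo
    intro r hr
    rw [Set.uIoo_of_le hM] at hr
    simp [hr.1]
  rw [h1, h2]
  simp

lemma aux_layer {A B : Type*} (s : Finset A) (t : Finset B) (x : A → ℝ) (y : B → ℝ) (M b n : ℝ)
    (hM : 0 ≤ M)
    (hx : ∀ e ∈ s, 0 ≤ x e ∧ x e ≤ M) (hy : ∀ v ∈ t, 0 ≤ y v ∧ y v ≤ M)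
    (h : ∀ r : ℝ, ∑ e ∈ s, (if r ≤ x e then (1:ℝ) else 0) ≤
      b * (∑ v ∈ t, (if r ≤ y v then (1:ℝ) else 0) + n)) :
    ∑ e ∈ s, x e ≤ b * (∑ v ∈ t, y v + M * n) := by
  have e1 : ∫ r in (0:ℝ)..M, ∑ e ∈ s, (if r ≤ x e then (1:ℝ) else 0) = ∑ e ∈ s, x e := by
    rw [intervalIntegral.integral_finsetSum (fun e he => (aux_int _ M (hx e he).1 (hx e he).2).1)]
    exact Finset.sum_congr rfl (fun e he => (aux_int _ M (hx e he).1 (hx e he).2).2)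
  have e2 : ∫ r in (0:ℝ)..M, ∑ v ∈ t, (if r ≤ y v then (1:ℝ) else 0) = ∑ v ∈ t, y v := by
    rw [intervalIntegral.integral_finsetSum (fun e he => (aux_int _ M (hy e he).1 (hy e he).2).1)]
    exact Finset.sum_congr rfl (fun e he => (aux_int _ M (hy e he).1 (hy e he).2).2)
  have i1 : IntervalIntegrable (fun r : ℝ => ∑ e ∈ s, (if r ≤ x e then (1:ℝ) else 0))
      MeasureTheory.volume 0 M := by
    have := IntervalIntegrable.sum s (fun e he => (aux_int _ M (hx e he).1 (hx e he).2).1)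
    simpa only [Finset.sum_fn] using this
  have i2 : IntervalIntegrable (fun r : ℝ => ∑ v ∈ t, (if r ≤ y v then (1:ℝ) else 0))
      MeasureTheory.volume 0 M := by
    have := IntervalIntegrable.sum t (fun e he => (aux_int _ M (hy e he).1 (hy e he).2).1)
    simpa only [Finset.sum_fn] using this
  have := intervalIntegral.integral_mono_on hM i1
    ((i2.add (intervalIntegrable_const (c := n))).const_mul b) (fun r _ => h r)
  rw [e1, intervalIntegral.integral_const_mul, intervalIntegral.integral_add i2
    intervalIntegrable_const, e2] at this
  simpa using this

lemma aux_fib {V C : Type*} [DecidableEq V] [Fintype C] [DecidableEq C] (ℓ : V → C)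
    (S : Finset V) : ∑ c : C, (colorClass ℓ S c).card = S.card :=
  (Finset.card_eq_sum_card_fiberwise (f := ℓ) (t := Finset.univ) (by simp)).symm

/-- Key lemma for the `1/3`-approximation: for an optimal LP solution `(x*, y*)` of `LP(p*)`
with `p*_c = |S*_c|`, some level set `S(r)`, `r ∈ {y*_v : v ∈ V} ∪ {0}`, satisfies one of the
three stated properties. -/
theorem stmt9 {V C : Type*} [Fintype V] [DecidableEq V] [Fintype C] [DecidableEq C]
    (G : SimpleGraph V) [DecidableRel G.Adj] (ℓ : V → C) (k : C → ℕ)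
    (hk : ∃ c : C, 1 ≤ k c)
    (Sstar : Finset V)
    (hfeas : ∀ c : C, k c ≤ (colorClass ℓ Sstar c).card)
    (hopt : ∀ T : Finset V, (∀ c : C, k c ≤ (colorClass ℓ T c).card) →
      density G T ≤ density G Sstar)
    (xstar : Sym2 V → ℝ) (ystar : V → ℝ)
    (hLPfeas : LPFeasible G ℓ (fun c => (colorClass ℓ Sstar c).card) xstar ystar)
    (hLPopt : ∀ (x : Sym2 V → ℝ) (y : V → ℝ),
      LPFeasible G ℓ (fun c => (colorClass ℓ Sstar c).card) x y →
      ∑ e ∈ G.edgeFinset, x e ≤ ∑ e ∈ G.edgeFinset, xstar e)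
    (lam : ℝ) (hlam : lam = ∑ e ∈ G.edgeFinset, xstar e) :
    ∃ r : ℝ, (r = 0 ∨ ∃ v : V, r = ystar v) ∧
      (let Sr : Finset V := Finset.univ.filter (fun v => r ≤ ystar v)
       (lam / 3 ≤ density G Sr ∧ Csat ℓ k Sr = Finset.univ) ∨
       (lam / 3 ≤ ((edgesIn G Sr).card : ℝ) /
            ((∑ c ∈ Csat ℓ k Sr, ((colorClass ℓ Sr c).card : ℝ)) +
             (∑ c ∈ Finset.univ \ Csat ℓ k Sr, (k c : ℝ))) ∧
          (Csat ℓ k Sr).Nonempty ∧ Csat ℓ k Sr ≠ Finset.univ) ∨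
       (((edgesIn G Sstar).card : ℝ) / 3 ≤ ((edgesIn G Sr).card : ℝ) ∧
          Csat ℓ k Sr = ∅)) := by
  have hfib := aux_fib ℓ Sstar
  obtain ⟨h1, h2, h3, h4, h5⟩ := hLPfeas
  rw [hfib] at h3
  simp only [hfib] at h2
  have hn : 0 < Sstar.card := by
    obtain ⟨c, hc⟩ := hk
    exact lt_of_lt_of_le (lt_of_lt_of_le hc (hfeas c)) (Finset.card_le_card (Finset.filter_subset _ _))
  have hnR : (0:ℝ) < Sstar.card := by exact_mod_cast hn
  have hlam0 : 0 ≤ lam := by rw [hlam]; exact Finset.sum_nonneg h4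
  have hxM : ∀ e ∈ G.edgeFinset, xstar e ≤ 1 / (Sstar.card : ℝ) := by
    intro e he
    induction e with
    | _ u v => exact (h1 _ he u (by simp)).trans (h3 u)
  have hsumy : ∑ v, ystar v = 1 := by
    rw [← Finset.sum_fiberwise (s := Finset.univ) (g := ℓ)]
    rw [Finset.sum_congr rfl (fun c _ => h2 c), ← Finset.sum_div, ← Nat.cast_sum, hfib]
    exact div_self hnR.ne'
  have hlow : ((edgesIn G Sstar).card : ℝ) / Sstar.card ≤ lam := by
    have := hLPopt (fun e => if e ∈ edgesIn G Sstar then 1 / (Sstar.card : ℝ) else 0)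
      (fun v => if v ∈ Sstar then 1 / (Sstar.card : ℝ) else 0) (by
        refine ⟨?_, ?_, ?_, ?_, ?_⟩
        · intro e he v hv
          dsimp only
          by_cases hE : e ∈ edgesIn G Sstar
          · have : v ∈ Sstar := (Finset.mem_filter.1 hE).2 v hv
            simp [hE, this]
          · simp only [hE, if_false]
            split_ifs <;> positivity
        · intro c
          rw [hfib, ← Finset.sum_filter, Finset.sum_const, nsmul_eq_mul, mul_one_div]
          congr 3
          ext v; simp [colorClass, and_comm]
        · intro v
          rw [hfib]
          dsimp only
          split_ifs
          · exact le_rfl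
          · positivity
        · intro e _
          dsimp only
          split_ifs <;> positivity
        · intro v
          dsimp only
          split_ifs <;> positivity)
    rw [← hlam, ← Finset.sum_filter, Finset.sum_const, nsmul_eq_mul, mul_one_div] at this
    refine le_trans (le_of_eq ?_) this
    congr 3
    ext e
    simp only [edgesIn, Finset.mem_filter]
    tauto
  have hlow' : ((edgesIn G Sstar).card : ℝ) ≤ lam * Sstar.card := by
    rwa [div_le_iff₀ hnR] at hlow
  by_contra hcon
  dsimp only at hcon
  push Not at hcon
  have key : ∀ r : ℝ, (r = 0 ∨ ∃ v : V, r = ystar v) →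
      ((edgesIn G (Finset.univ.filter (fun v => r ≤ ystar v))).card : ℝ) ≤
        lam / 3 * (((Finset.univ.filter (fun v => r ≤ ystar v)).card : ℝ) + Sstar.card) := by
    intro r hr
    obtain ⟨c1, c2, c3⟩ := hcon r hr
    generalize Finset.univ.filter (fun v => r ≤ ystar v) = S at c1 c2 c3 ⊢
    have hS0 : (0:ℝ) ≤ S.card := by positivity
    by_cases hu : Csat ℓ k S = Finset.univ
    · have hd : density G S < lam / 3 := by
        by_contra hge
        exact c1 (not_lt.1 hge) hu
      have hpos : (0:ℝ) < S.card := by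
        obtain ⟨c, hc⟩ := hk
        have hcs : c ∈ Csat ℓ k S := by rw [hu]; simp
        have := (Finset.mem_filter.1 hcs).2
        have h' : (colorClass ℓ S c).card ≤ S.card :=
          Finset.card_le_card (Finset.filter_subset _ _)
        exact_mod_cast (by omega : 0 < S.card)
      rw [density, div_lt_iff₀ hpos] at hd
      have : 0 ≤ lam / 3 * Sstar.card := by positivity
      linarith
    · by_cases hem : Csat ℓ k S = ∅
      · have hd : ((edgesIn G S).card : ℝ) < ((edgesIn G Sstar).card : ℝ) / 3 := by
          by_contra hge
          exact (c3 (not_lt.1 hge)).ne_empty hem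
        have : 0 ≤ lam / 3 * S.card := by positivity
        linarith
      · have hd : ((edgesIn G S).card : ℝ) /
            ((∑ c ∈ Csat ℓ k S, ((colorClass ℓ S c).card : ℝ)) +
             (∑ c ∈ Finset.univ \ Csat ℓ k S, (k c : ℝ))) < lam / 3 := by
          by_contra hge
          exact hu (c2 (not_lt.1 hge) (Finset.nonempty_iff_ne_empty.2 hem))
        have hb1 : (∑ c ∈ Csat ℓ k S, ((colorClass ℓ S c).card : ℝ)) ≤ S.card := by
          rw [← aux_fib ℓ S, Nat.cast_sum]
          exact Finset.sum_le_sum_of_subset_of_nonneg (Finset.subset_univ _)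
            (fun _ _ _ => by positivity)
        have hb2 : (∑ c ∈ Finset.univ \ Csat ℓ k S, (k c : ℝ)) ≤ Sstar.card := by
          rw [← aux_fib ℓ Sstar, Nat.cast_sum]
          refine (Finset.sum_le_sum (fun c _ => (Nat.cast_le (α := ℝ)).2 (hfeas c))).trans ?_
          exact Finset.sum_le_sum_of_subset_of_nonneg (Finset.subset_univ _)
            (fun _ _ _ => by positivity)
        have hb3 : (0:ℝ) < ∑ c ∈ Finset.univ \ Csat ℓ k S, (k c : ℝ) := by
          apply Finset.sum_pos
          · intro c hc
            simp only [Csat, Finset.mem_sdiff, Finset.mem_univ, true_and, Finset.mem_filter] at hc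
            exact_mod_cast (by omega : 0 < k c)
          · rw [Finset.sdiff_nonempty]
            intro hsub
            exact hu (Finset.univ_subset_iff.1 hsub)
        have hb4 : (0:ℝ) ≤ (∑ c ∈ Csat ℓ k S, ((colorClass ℓ S c).card : ℝ)) := by positivity
        rw [div_lt_iff₀ (by linarith)] at hd
        refine hd.le.trans ?_
        gcongr
  have hlampos : 0 < lam := by
    rcases hlam0.lt_or_eq with h | h
    · exact h
    · exfalso
      refine (hcon 0 (Or.inl rfl)).1 ?_ ?_
      · rw [← h, density]; simp; positivity
      · ext c
        simp only [Csat, Finset.mem_filter, Finset.mem_univ, true_and, iff_true]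
        refine (hfeas c).trans (Finset.card_le_card ?_)
        apply Finset.filter_subset_filter
        intro v _
        simp [h5 v]
  have hall : ∀ r : ℝ, ∑ e ∈ G.edgeFinset, (if r ≤ xstar e then (1:ℝ) else 0) ≤
      lam / 3 * (∑ v, (if r ≤ ystar v then (1:ℝ) else 0) + Sstar.card) := by
    intro r
    simp only [Finset.sum_boole]
    have hsub : ((G.edgeFinset.filter (fun e => r ≤ xstar e)).card : ℝ) ≤
        (edgesIn G (Finset.univ.filter (fun v => r ≤ ystar v))).card := by
      apply Nat.cast_le.2
      apply Finset.card_le_card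
      intro e he
      rw [Finset.mem_filter] at he
      simp only [edgesIn, Finset.mem_filter, Finset.mem_univ, true_and]
      exact ⟨he.1, fun v hv => he.2.trans (h1 e he.1 v hv)⟩
    refine hsub.trans ?_
    rcases (Finset.univ.filter (fun v => r ≤ ystar v)).eq_empty_or_nonempty with hE | hE
    · have : edgesIn G (∅ : Finset V) = ∅ := by
        ext e
        induction e with
        | _ u v =>
          simp only [edgesIn, Finset.mem_filter, Finset.notMem_empty, iff_false]
          rintro ⟨-, h⟩
          exact h u (by simp)
      rw [hE, this]
      simp; positivity
    · obtain ⟨w, hw, hmin⟩ := Finset.exists_min_image _ ystar hE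
      have heq : Finset.univ.filter (fun v => r ≤ ystar v)
          = Finset.univ.filter (fun v => ystar w ≤ ystar v) := by
        ext v
        simp only [Finset.mem_filter, Finset.mem_univ, true_and] at hw hmin ⊢
        exact ⟨hmin v, hw.trans⟩
      rw [heq]
      exact key _ (Or.inr ⟨w, rfl⟩)
  have hfin := aux_layer G.edgeFinset Finset.univ xstar ystar (1 / (Sstar.card : ℝ)) (lam / 3)
    Sstar.card (by positivity) (fun e he => ⟨h4 e he, hxM e he⟩) (fun v _ => ⟨h5 v, h3 v⟩) hall
  rw [← hlam, hsumy, one_div_mul_cancel hnR.ne'] at hfin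
  linarith
end

section
/- Let G = (V, E) be a finite simple undirected graph, ℓ : V → C a coloring, and k⃗ = (k_c)_{c∈C} ∈ ℤ_{≥0}^{|C|}. Suppose S* ⊆ V is feasible for Dal k⃗ S with |S*_c| > k_c for every c ∈ C with k_c ≥ 1, and suppose S* is optimal, i.e., d(S*) ≥ d(T) for every feasible T ⊆ V. Then deg_{S*}(v) ≥ d(S*) for every v ∈ S*. -/
open Finset

/-- `deg_S(v)`, the degree of `v` in the induced subgraph `G[S]`. -/
def degIn {V : Type*} [DecidableEq V] (G : SimpleGraph V) [DecidableRel G.Adj]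
    (S : Finset V) (v : V) : ℕ :=
  (S.filter (fun u => G.Adj v u)).card

theorem edgesIn_card_le_erase {V : Type*} [Fintype V] [DecidableEq V]
    (G : SimpleGraph V) [DecidableRel G.Adj] (S : Finset V) (v : V) :
    (edgesIn G S).card ≤ (edgesIn G (S.erase v)).card + degIn G S v := by
  have hsub : edgesIn G S ⊆ edgesIn G (S.erase v) ∪
      (S.filter (fun u => G.Adj v u)).image (fun u => s(v, u)) := by
    intro e he
    simp only [edgesIn, Finset.mem_filter, SimpleGraph.mem_edgeFinset] at he
    obtain ⟨h1, h2⟩ := he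
    rw [Finset.mem_union]
    by_cases hv : v ∈ e
    · right
      obtain ⟨u, rfl⟩ := Sym2.mem_iff_exists.1 hv
      refine Finset.mem_image.2 ⟨u, Finset.mem_filter.2 ⟨h2 u (by simp), by simpa using h1⟩, rfl⟩
    · left
      simp only [edgesIn, Finset.mem_filter, SimpleGraph.mem_edgeFinset]
      refine ⟨h1, fun w hw => Finset.mem_erase.2 ⟨?_, h2 w hw⟩⟩
      rintro rfl
      exact hv hw
  exact (Finset.card_le_card hsub).trans ((Finset.card_union_le _ _).trans
    (Nat.add_le_add_left Finset.card_image_le _))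

/-- If `S*` is an optimal solution of Dal`k⃗`S satisfying all demands strictly, then every node
of `S*` has induced degree at least `d(S*)`. -/
theorem stmt12 {V C : Type*} [Fintype V] [DecidableEq V] [Fintype C] [DecidableEq C]
    (G : SimpleGraph V) [DecidableRel G.Adj] (ℓ : V → C) (k : C → ℕ)
    (Sstar : Finset V)
    (hfeas : ∀ c : C, k c ≤ (colorClass ℓ Sstar c).card)
    (hstrict : ∀ c : C, 1 ≤ k c → k c < (colorClass ℓ Sstar c).card)
    (hopt : ∀ T : Finset V, (∀ c : C, k c ≤ (colorClass ℓ T c).card) →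
      density G T ≤ density G Sstar) :
    ∀ v ∈ Sstar, density G Sstar ≤ (degIn G Sstar v : ℝ) := by
  intro v hv
  have hT : ∀ c : C, k c ≤ (colorClass ℓ (Sstar.erase v) c).card := by
    intro c
    rcases Nat.eq_zero_or_pos (k c) with h | h
    · omega
    · have h1 := hstrict c h
      have h2 : colorClass ℓ (Sstar.erase v) c = (colorClass ℓ Sstar c).erase v := by
        ext w
        simp only [colorClass, Finset.mem_filter, Finset.mem_erase]
        tauto
      have h3 := Finset.pred_card_le_card_erase (s := colorClass ℓ Sstar c) (a := v)
      rw [h2]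
      omega
  have hd := hopt _ hT
  have hE : ((edgesIn G Sstar).card : ℝ) ≤
      (edgesIn G (Sstar.erase v)).card + degIn G Sstar v := by
    exact_mod_cast edgesIn_card_le_erase G Sstar v
  have hc : ((Sstar.erase v).card : ℝ) + 1 = Sstar.card := by
    exact_mod_cast Finset.card_erase_add_one hv
  have hpos : (0 : ℝ) < Sstar.card := by
    exact_mod_cast Finset.card_pos.2 ⟨v, hv⟩
  have hmul : ((edgesIn G (Sstar.erase v)).card : ℝ) =
      density G (Sstar.erase v) * (Sstar.erase v).card := by
    unfold density
    by_cases h0 : Sstar.erase v = ∅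
    · have : edgesIn G (∅ : Finset V) = ∅ := by
        ext e
        induction e using Sym2.ind with
        | _ a b => simpa [edgesIn] using fun _ => ⟨a, fun h => absurd rfl h⟩
      rw [h0, this]
      simp
    · have : ((Sstar.erase v).card : ℝ) ≠ 0 := by
        exact_mod_cast fun h => h0 (Finset.card_eq_zero.1 h)
      field_simp
  have hS : ((edgesIn G Sstar).card : ℝ) = density G Sstar * Sstar.card := by
    unfold density
    field_simp
  have hmono := mul_le_mul_of_nonneg_right hd (Nat.cast_nonneg (α := ℝ) (Sstar.erase v).card)
  rw [← hmul] at hmono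
  rw [← hc] at hS
  linarith
end
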